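/- arXiv:2502.01032 — 2 statements merged into one kernel-verified Lean document; each statement's English description precedes it below -/
import Mathlib

section
/- Let Y and W be jointly Gaussian random variables: Y = μ_Y + c Z_1 with c ≠ 0 and W = μ_W + a Z_1 + b Z_2, where Z_1, Z_2 are independent standard Gaussian variables. Let φ : ℝ → ℝ be differentiable with φ'(Y) integrable, φ(Y) integrable, and φ(Y)·W integrable. Then the expectation of the gated-linear-unit output component satisfies E[φ(Y)·W] = E[φ(Y)]·E[W] + Cov(Y, W)·E[φ'(Y)]. -/
open MeasureTheory ProbabilityTheory Real

theorem hasDerivAt_gaussianPDFReal_zero_one (x : ℝ) :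
    HasDerivAt (gaussianPDFReal 0 1) (-(x * gaussianPDFReal 0 1 x)) x := by
  have h : HasDerivAt (fun y : ℝ => -(y - 0) ^ 2 / (2 * ((1 : NNReal) : ℝ))) (-x) x := by
    have := ((((hasDerivAt_id x).sub_const 0).pow 2).neg).div_const (2 * ((1 : NNReal) : ℝ))
    refine this.congr_deriv ?_
    simp
    ring
  have h' := h.exp.const_mul (√(2 * π * ((1 : NNReal) : ℝ)))⁻¹
  rw [gaussianPDFReal_def]
  refine h'.congr_deriv ?_
  ring

theorem integrable_gaussianReal_iff {f : ℝ → ℝ} {m : ℝ} {v : NNReal} (hv : v ≠ 0) :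
    Integrable f (gaussianReal m v) ↔ Integrable fun x => gaussianPDFReal m v x * f x := by
  rw [gaussianReal_of_var_ne_zero m hv,
    integrable_withDensity_iff_integrable_smul' (measurable_gaussianPDF m v)
      (Filter.Eventually.of_forall fun _ => gaussianPDF_lt_top)]
  simp [toReal_gaussianPDF]

/-- Stein's identity for the standard Gaussian measure. -/
theorem integral_mul_id_gaussianReal {g g' : ℝ → ℝ} (hg : ∀ x, HasDerivAt g (g' x) x)
    (h0 : Integrable g (gaussianReal 0 1)) (h1 : Integrable g' (gaussianReal 0 1))
    (hx : Integrable (fun x => g x * x) (gaussianReal 0 1)) :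
    ∫ x, g x * x ∂gaussianReal 0 1 = ∫ x, g' x ∂gaussianReal 0 1 := by
  rw [integrable_gaussianReal_iff one_ne_zero] at h0 h1 hx
  simp only [integral_gaussianReal_eq_integral_smul (one_ne_zero : (1 : NNReal) ≠ 0), smul_eq_mul]
  rw [eq_comm, ← sub_eq_zero, ← integral_sub h1 hx]
  refine integral_eq_zero_of_hasDerivAt_of_integrable (fun x => ?_) (h1.sub hx) h0
  refine ((hasDerivAt_gaussianPDFReal_zero_one x).mul (hg x)).congr_deriv ?_
  ring

theorem integrable_id_gaussianReal (m : ℝ) (v : NNReal) :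
    Integrable (fun x : ℝ => x) (gaussianReal m v) :=
  memLp_one_iff_integrable.1 (memLp_id_gaussianReal 1)

theorem integrable_mul_self_gaussianReal (m : ℝ) (v : NNReal) :
    Integrable (fun x : ℝ => x * x) (gaussianReal m v) := by
  have h : MemLp (fun x : ℝ => x) 2 (gaussianReal m v) := memLp_id_gaussianReal 2
  exact h.integrable_mul h

theorem integral_mul_self_gaussianReal_zero_one :
    ∫ x, x * x ∂gaussianReal 0 1 = 1 := by
  rw [integral_mul_id_gaussianReal (g := fun x => x) (g' := fun _ => 1) hasDerivAt_id
    (integrable_id_gaussianReal 0 1) (integrable_const 1) (integrable_mul_self_gaussianReal 0 1)]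
  simp

/-- Integrating the product of a function of the first coordinate with an affine function
against the standard Gaussian measure on the plane. -/
theorem integral_mul_affine_gaussianReal_prod {g : ℝ → ℝ} (m a b : ℝ)
    (hg : Integrable g (gaussianReal 0 1))
    (hx : Integrable (fun x => a * (g x * x)) (gaussianReal 0 1)) :
    ∫ ω, g ω.1 * (m + a * ω.1 + b * ω.2) ∂(gaussianReal 0 1).prod (gaussianReal 0 1) =
      m * ∫ x, g x ∂gaussianReal 0 1 + a * ∫ x, g x * x ∂gaussianReal 0 1 := by
  have e : (fun ω : ℝ × ℝ => g ω.1 * (m + a * ω.1 + b * ω.2)) =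
      fun ω => (m * g ω.1 + a * (g ω.1 * ω.1)) + b * (g ω.1 * ω.2) := by
    funext ω
    ring
  have i : Integrable (fun x => m * g x + a * (g x * x)) (gaussianReal 0 1) :=
    (hg.const_mul m).add hx
  rw [e, integral_add (i.comp_fst (gaussianReal 0 1))
    ((hg.mul_prod (integrable_id_gaussianReal 0 1)).const_mul b), integral_const_mul,
    integral_prod_mul g fun y => y,
    integral_fun_fst fun x => m * g x + a * (g x * x),
    integral_add (hg.const_mul m) hx, integral_const_mul, integral_const_mul]
  simp

/-- Expectation of a gated-linear-unit output component for jointly Gaussian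
preactivations.  Let `Y = μY + c Z₁` with `c ≠ 0` and `W = μW + a Z₁ + b Z₂`,
where `Z₁, Z₂` are independent standard Gaussians (the underlying space is
`ℝ × ℝ ∋ (Z₁, Z₂)` with the product of two standard Gaussian measures).  If
`φ` is differentiable with `φ'(Y)`, `φ(Y)` and `φ(Y)·W` integrable, then
`E[φ(Y)·W] = E[φ(Y)]·E[W] + Cov(Y, W)·E[φ'(Y)]`, where covariance is written
out as `Cov(U,V) = E[UV] - E[U]E[V]`. -/
theorem glu_mean
    (μY μW a b c : ℝ) (hc : c ≠ 0)
    (P : Measure (ℝ × ℝ))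
    (hP : P = (gaussianReal 0 1).prod (gaussianReal 0 1))
    (Y W : ℝ × ℝ → ℝ)
    (hY : Y = fun ω => μY + c * ω.1)
    (hW : W = fun ω => μW + a * ω.1 + b * ω.2)
    (φ : ℝ → ℝ) (hφ : Differentiable ℝ φ)
    (h1 : Integrable (fun ω => deriv φ (Y ω)) P)
    (h2 : Integrable (fun ω => φ (Y ω)) P)
    (h3 : Integrable (fun ω => φ (Y ω) * W ω) P) :
    ∫ ω, φ (Y ω) * W ω ∂P =
      (∫ ω, φ (Y ω) ∂P) * (∫ ω, W ω ∂P) +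
        ((∫ ω, Y ω * W ω ∂P) - (∫ ω, Y ω ∂P) * ∫ ω, W ω ∂P) *
          ∫ ω, deriv φ (Y ω) ∂P := by
  subst hP hY hW
  set γ := gaussianReal 0 1 with hγ
  have fst_iff {f : ℝ → ℝ} (hf : Measurable f) :
      Integrable (fun ω : ℝ × ℝ => f ω.1) (γ.prod γ) ↔ Integrable f γ :=
    measurePreserving_fst.integrable_comp hf.aestronglyMeasurable
  have hid : Integrable (fun x : ℝ => x) γ := integrable_id_gaussianReal 0 1
  have hsq : Integrable (fun x : ℝ => x * x) γ := integrable_mul_self_gaussianReal 0 1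
  have hmean : ∫ x, x ∂γ = 0 := integral_id_gaussianReal
  have haff : Measurable fun x : ℝ => μY + c * x := by fun_prop
  have hgm : Measurable fun x => φ (μY + c * x) := hφ.continuous.measurable.comp haff
  have hg'm : Measurable fun x => deriv φ (μY + c * x) := (measurable_deriv φ).comp haff
  have hg : Integrable (fun x => φ (μY + c * x)) γ := (fst_iff hgm).1 h2
  have hg' : Integrable (fun x => deriv φ (μY + c * x)) γ := (fst_iff hg'm).1 h1
  have hgx : Integrable (fun x => a * (φ (μY + c * x) * x)) γ := by
    refine (fst_iff ((hgm.mul measurable_id).const_mul a)).1 ?_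
    refine ((h3.sub (h2.const_mul μW)).sub ((hg.mul_prod hid).const_mul b)).congr ?_
    refine Filter.Eventually.of_forall fun ω => ?_
    simp only [Pi.sub_apply, Pi.mul_apply, id_eq]
    ring
  have stein : a * ∫ x, φ (μY + c * x) * x ∂γ =
      a * (c * ∫ x, deriv φ (μY + c * x) ∂γ) := by
    rcases eq_or_ne a 0 with rfl | ha
    · simp
    · rw [← integral_const_mul c, integral_mul_id_gaussianReal (fun x => ?_) hg (hg'.const_mul c)
        ((integrable_const_mul_iff (IsUnit.mk0 a ha) _).1 hgx)]
      have hd : HasDerivAt (fun x : ℝ => μY + c * x) c x := by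
        simpa using ((hasDerivAt_id x).const_mul c).const_add μY
      exact ((hφ _).hasDerivAt.comp x hd).congr_deriv (mul_comm _ _)
  have hY : Integrable (fun x => μY + c * x) γ := (integrable_const μY).add (hid.const_mul c)
  have iY : ∫ x, μY + c * x ∂γ = μY := by
    rw [integral_add (integrable_const μY) (hid.const_mul c), integral_const_mul, hmean]
    simp
  have hYx : Integrable (fun x => (μY + c * x) * x) γ := by
    simp only [add_mul, mul_assoc]
    exact (hid.const_mul μY).add (hsq.const_mul c)
  have iYx : ∫ x, (μY + c * x) * x ∂γ = c := by
    simp only [add_mul, mul_assoc]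
    rw [integral_add (hid.const_mul μY) (hsq.const_mul c), integral_const_mul, integral_const_mul,
      hmean, hγ, integral_mul_self_gaussianReal_zero_one]
    ring
  have iW : ∫ ω : ℝ × ℝ, μW + a * ω.1 + b * ω.2 ∂γ.prod γ = μW := by
    simpa [← hγ, hmean] using integral_mul_affine_gaussianReal_prod (g := fun _ => 1) μW a b
      (integrable_const 1) (by simpa using hid.const_mul a)
  have iφW := integral_mul_affine_gaussianReal_prod μW a b hg hgx
  have iYW := integral_mul_affine_gaussianReal_prod μW a b hY (hYx.const_mul a)
  have φ_fst := integral_fun_fst (μ := γ) (ν := γ) fun x => φ (μY + c * x)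
  have deriv_fst := integral_fun_fst (μ := γ) (ν := γ) fun x => deriv φ (μY + c * x)
  have Y_fst := integral_fun_fst (μ := γ) (ν := γ) fun x => μY + c * x
  simp only [probReal_univ, one_smul] at φ_fst deriv_fst Y_fst
  rw [iφW, iYW, iW, φ_fst, deriv_fst, Y_fst, ← hγ, stein, iY, iYx]
  ring
end

section
/- For all real numbers a and b, ∫_{−∞}^∞ Φ(a + bx) · φ(x) dx = Φ(a/√(1 + b²)). -/
open MeasureTheory Real

/-- The standard normal density `φ(z) = exp(-z²/2)/√(2π)`. -/
noncomputable def stdNormalPDF (z : ℝ) : ℝ := Real.exp (-(z ^ 2) / 2) / Real.sqrt (2 * Real.pi)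

/-- The standard normal CDF `Φ(x) = ∫_{-∞}^x φ(z) dz`. -/
noncomputable def stdNormalCDF (x : ℝ) : ℝ := ∫ z in Set.Iic x, stdNormalPDF z

open ProbabilityTheory

lemma stdNormalPDF_eq_gaussianPDFReal : stdNormalPDF = gaussianPDFReal 0 1 := by
  ext x
  simp [stdNormalPDF, gaussianPDFReal, div_eq_inv_mul]

lemma stdNormalCDF_eq_measureReal_Iic (x : ℝ) :
    stdNormalCDF x = (gaussianReal 0 1).real (Set.Iic x) := by
  rw [Measure.real, gaussianReal_apply_eq_integral 0 one_ne_zero, ENNReal.toReal_ofReal,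
    stdNormalCDF, stdNormalPDF_eq_gaussianPDFReal]
  exact integral_nonneg fun y ↦ gaussianPDFReal_nonneg 0 1 y

/-- If `X` and `Z` are independent standard normal variables, then `Z - b * X` is normal with
variance `1 + b ^ 2`, i.e. it has the law of `√(1 + b ^ 2) * Z`. -/
lemma gaussianReal_map_neg_mul_conv (b : ℝ) :
    (gaussianReal 0 1).map (-b * ·) ∗ gaussianReal 0 1 =
      (gaussianReal 0 1).map (√(1 + b ^ 2) * ·) := by
  rw [gaussianReal_map_const_mul, gaussianReal_map_const_mul, gaussianReal_conv_gaussianReal]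
  congr 1
  · simp
  · ext
    have h : 0 ≤ b ^ 2 + 1 := by positivity
    simp [Real.sq_sqrt h, add_comm]

lemma lintegral_gaussianReal_Iic_affine (a b : ℝ) :
    ∫⁻ x, gaussianReal 0 1 (Set.Iic (a + b * x)) ∂gaussianReal 0 1 =
      gaussianReal 0 1 (Set.Iic (a / √(1 + b ^ 2))) := by
  have hc : 0 < √(1 + b ^ 2) := by positivity
  have hs : MeasurableSet ((fun p : ℝ × ℝ ↦ p.1 + p.2) ⁻¹' Set.Iic a) :=
    measurable_add measurableSet_Iic
  have h := congrArg (fun μ : Measure ℝ ↦ μ (Set.Iic a)) (gaussianReal_map_neg_mul_conv b)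
  simp only [Measure.conv] at h
  rw [Measure.map_apply (by fun_prop) measurableSet_Iic,
    Measure.map_apply (by fun_prop) measurableSet_Iic,
    Measure.prod_apply hs, lintegral_map (measurable_measure_prodMk_left hs) (by fun_prop)] at h
  convert h using 1
  · refine lintegral_congr fun x ↦ congrArg _ (Set.ext fun z ↦ ?_)
    simp only [Set.mem_Iic, Set.mem_preimage]
    constructor <;> intro _ <;> linarith
  · refine congrArg _ (Set.ext fun z ↦ ?_)
    simp only [Set.mem_Iic, Set.mem_preimage]
    rw [le_div_iff₀' hc]

/-- For all reals `a, b`: `∫_{-∞}^∞ Φ(a + bx) φ(x) dx = Φ(a/√(1+b²))`. -/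
theorem integral_normalCDF (a b : ℝ) :
    ∫ x : ℝ, stdNormalCDF (a + b * x) * stdNormalPDF x =
      stdNormalCDF (a / Real.sqrt (1 + b ^ 2)) := by
  have hmono : Monotone fun x ↦ gaussianReal 0 1 (Set.Iic x) :=
    fun _ _ h ↦ measure_mono (Set.Iic_subset_Iic.2 h)
  have hmeas : Measurable fun x ↦ gaussianReal 0 1 (Set.Iic (a + b * x)) :=
    hmono.measurable.comp (by fun_prop)
  calc ∫ x : ℝ, stdNormalCDF (a + b * x) * stdNormalPDF x
      = ∫ x, (gaussianReal 0 1 (Set.Iic (a + b * x))).toReal ∂gaussianReal 0 1 := by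
        rw [integral_gaussianReal_eq_integral_smul one_ne_zero]
        simp [stdNormalPDF_eq_gaussianPDFReal, stdNormalCDF_eq_measureReal_Iic, Measure.real,
          mul_comm]
    _ = stdNormalCDF (a / √(1 + b ^ 2)) := by
        rw [integral_toReal hmeas.aemeasurable (.of_forall fun _ ↦ measure_lt_top _ _),
          lintegral_gaussianReal_Iic_affine, stdNormalCDF_eq_measureReal_Iic, Measure.real]
end
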